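/- Let k ≥ 0, v ∈ (P_{k+1}(ℝ³))³ and f ∈ P_{k-1}(ℝ³). If curl v(x) = f(x) x for all x ∈ ℝ³, then f ≡ 0 and curl v ≡ 0. -/

import Mathlib

/-- `PolyDeg k` : real polynomial functions `ℝ³ → ℝ` of total degree at most `k`
(with the convention that `PolyDeg k = {0}` for `k < 0`, in particular `P_{-1} = {0}`). -/
def PolyDeg (k : ℤ) : Set ((Fin 3 → ℝ) → ℝ) :=
  {f | ∃ P : MvPolynomial (Fin 3) ℝ,
    (∀ m ∈ P.support, ((m.sum fun _ e => e : ℕ) : ℤ) ≤ k) ∧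
    ∀ x, f x = MvPolynomial.eval x P}

/-- `PolyVec k` : vector fields `ℝ³ → ℝ³` whose three components lie in `PolyDeg k`. -/
def PolyVec (k : ℤ) : Set ((Fin 3 → ℝ) → (Fin 3 → ℝ)) :=
  {v | ∀ i : Fin 3, (fun x => v x i) ∈ PolyDeg k}

/-- Partial derivative in the `i`-th coordinate direction. -/
noncomputable def pd3 (i : Fin 3) (f : (Fin 3 → ℝ) → ℝ) (x : Fin 3 → ℝ) : ℝ :=
  fderiv ℝ f x (Pi.single i 1)

/-- The curl `∇ × v` of a vector field on `ℝ³`. -/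
noncomputable def curl3 (v : (Fin 3 → ℝ) → (Fin 3 → ℝ)) (x : Fin 3 → ℝ) : Fin 3 → ℝ :=
  ![pd3 1 (fun y => v y 2) x - pd3 2 (fun y => v y 1) x,
    pd3 2 (fun y => v y 0) x - pd3 0 (fun y => v y 2) x,
    pd3 0 (fun y => v y 1) x - pd3 1 (fun y => v y 0) x]

namespace MvPolynomial

theorem hasFDerivAt_eval {σ : Type*} [Fintype σ] (P : MvPolynomial σ ℝ) (x : σ → ℝ) :
    HasFDerivAt (fun y => eval y P)
      (∑ i, eval x (pderiv i P) • ContinuousLinearMap.proj (R := ℝ) (φ := fun _ : σ => ℝ) i) x := by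
  classical
  induction P using MvPolynomial.induction_on with
  | C a => simpa using hasFDerivAt_const a x
  | add p q hp hq =>
    simp only [map_add, add_smul, Finset.sum_add_distrib]
    exact hp.add hq
  | mul_X p j hp =>
    have hj : HasFDerivAt (fun y : σ → ℝ => y j)
        (ContinuousLinearMap.proj (R := ℝ) (φ := fun _ : σ => ℝ) j) x :=
      hasFDerivAt_apply j x
    simp only [map_mul, eval_X]
    refine (hp.mul hj).congr_fderiv ?_
    ext v
    simp [Pi.single_apply, Finset.mul_sum, add_mul, Finset.sum_add_distrib, apply_ite,
      mul_assoc]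

theorem pderiv_comm {R σ : Type*} [CommSemiring R] (i j : σ) (P : MvPolynomial σ R) :
    pderiv i (pderiv j P) = pderiv j (pderiv i P) := by
  obtain rfl | hij := eq_or_ne i j
  · rfl
  ext m
  simp [coeff_pderiv, hij, hij.symm, add_right_comm, mul_right_comm]

theorem coeff_sum_pderiv_mul_X {R σ : Type*} [CommSemiring R] [Fintype σ]
    (F : MvPolynomial σ R) (m : σ →₀ ℕ) :
    coeff m (∑ i, pderiv i (F * X i)) = coeff m F * ∑ i, ((m i : R) + 1) := by
  simp only [coeff_sum, coeff_pderiv, coeff_mul_X, Finset.mul_sum]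

theorem eq_zero_of_sum_pderiv_mul_X_eq_zero {R σ : Type*} [CommRing R] [IsDomain R] [CharZero R]
    [Fintype σ] [Nonempty σ] {F : MvPolynomial σ R} (h : ∑ i, pderiv i (F * X i) = 0) :
    F = 0 := by
  ext m
  have hm := coeff_sum_pderiv_mul_X F m
  rw [h, coeff_zero, eq_comm, mul_eq_zero] at hm
  refine hm.resolve_right ?_
  have hpos : 0 < ∑ i, (m i + 1) := Finset.sum_pos (fun i _ => Nat.succ_pos _) Finset.univ_nonempty
  exact_mod_cast hpos.ne'

end MvPolynomial

theorem pd3_eval (i : Fin 3) (P : MvPolynomial (Fin 3) ℝ) (x : Fin 3 → ℝ) :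
    pd3 i (fun y => MvPolynomial.eval y P) x = MvPolynomial.eval x (MvPolynomial.pderiv i P) := by
  rw [pd3, (MvPolynomial.hasFDerivAt_eval P x).fderiv]
  simp [Pi.single_apply]

/-- Trivial intersection of `R_k = curl (P_{k+1})³` and `R_k^⊕ = x P_{k-1}`:
if `curl v (x) = f(x) x` for all `x`, with `v ∈ (P_{k+1})³` and `f ∈ P_{k-1}`,
then `f ≡ 0` and `curl v ≡ 0`. -/
theorem statement3 (k : ℕ) (v : (Fin 3 → ℝ) → (Fin 3 → ℝ)) (f : (Fin 3 → ℝ) → ℝ)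
    (hv : v ∈ PolyVec ((k : ℤ) + 1)) (hf : f ∈ PolyDeg ((k : ℤ) - 1))
    (h : ∀ x, curl3 v x = f x • x) :
    (∀ x, f x = 0) ∧ (∀ x, curl3 v x = 0) := by
  obtain ⟨F, -, hF⟩ := hf
  choose V _ hV using hv
  have hpd (i j : Fin 3) (x : Fin 3 → ℝ) :
      pd3 i (fun y => v y j) x = MvPolynomial.eval x (MvPolynomial.pderiv i (V j)) := by
    rw [← pd3_eval]
    exact congrArg (fun g => pd3 i g x) (funext (hV j))
  have h0 : F * .X 0 = MvPolynomial.pderiv 1 (V 2) - MvPolynomial.pderiv 2 (V 1) :=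
    MvPolynomial.funext fun x => by
      simpa [curl3, hpd, hF] using (congrFun (h x) 0).symm
  have h1 : F * .X 1 = MvPolynomial.pderiv 2 (V 0) - MvPolynomial.pderiv 0 (V 2) :=
    MvPolynomial.funext fun x => by
      simpa [curl3, hpd, hF] using (congrFun (h x) 1).symm
  have h2 : F * .X 2 = MvPolynomial.pderiv 0 (V 1) - MvPolynomial.pderiv 1 (V 0) :=
    MvPolynomial.funext fun x => by
      simpa [curl3, hpd, hF] using (congrFun (h x) 2).symm
  have hF0 : F = 0 := by
    apply MvPolynomial.eq_zero_of_sum_pderiv_mul_X_eq_zero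
    rw [Fin.sum_univ_three, h0, h1, h2]
    simp only [map_sub]
    rw [MvPolynomial.pderiv_comm 1 0, MvPolynomial.pderiv_comm 2 0, MvPolynomial.pderiv_comm 2 1]
    ring
  have hf0 (x : Fin 3 → ℝ) : f x = 0 := by rw [hF, hF0, map_zero]
  exact ⟨hf0, fun x => by rw [h, hf0, zero_smul]⟩
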